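/- arXiv:q-alg/9612016 — 2 statements merged into one kernel-verified Lean document; each statement's English description precedes it below -/
import Mathlib

section
/- Let $A$ be a unital associative algebra over a field $F$, $q \in F^\times$ not a root of unity, and $r \geq 1$. Suppose $B_1, \dots, B_r \in A$ are nilpotent and $K_1, \dots, K_r \in A$ are invertible and pairwise commuting, with the relations: $K_i B_j = B_j K_i$ for $i \neq j$; $K_i B_i = q^{-1} B_i K_i$ for all $i$; and $B_j B_i = q\, B_i B_j$ for $i < j$. Set $\mathcal{O} = \sum_{a=1}^{r} B_a K_{a+1} K_{a+2} \cdots K_r$. Then $\mathcal{O}$ is nilpotent, and for any left $A$-module $M$ and any $v \in M$ with $K_i v = v$ for all $i$, one has $\exp_q(\mathcal{O})\, v = \exp_q(B_1)\, \exp_q(B_2) \cdots \exp_q(B_r)\, v$. (This is the abstract form of the factorization $\exp_q(\mathcal{O})(1 \otimes v) = \exp_q(\mathcal{O}_1) \cdots \exp_q(\mathcal{O}_{m+n-1})(1 \otimes v)$ used in the Bott–Borel–Weil construction for $U_q(gl(m|n))$.) -/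
open scoped BigOperators

/-- The symmetric q-integer `[k]_q = (q^k - q^{-k})/(q - q^{-1}) = q^{k-1} + q^{k-3} + ⋯ + q^{1-k}`. -/
def qint {F : Type*} [Field F] (q : F) (k : ℕ) : F :=
  ∑ i ∈ Finset.range k, q ^ (k - 1 - i) * q⁻¹ ^ i

/-- The q-factorial `[k]_q! = [1]_q [2]_q ⋯ [k]_q`. -/
def qfact {F : Type*} [Field F] (q : F) : ℕ → F
  | 0 => 1
  | k + 1 => qfact q k * qint q (k + 1)

/-- The truncation `∑_{k<N} x^k/[k]_q!` of the q-exponential; for a nilpotent `x` with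
`x^N = 0` this equals the (finite) sum `exp_q(x) = ∑_{k≥0} x^k/[k]_q!`. -/
def expqTrunc {F : Type*} [Field F] {A : Type*} [Ring A] [Algebra F A]
    (q : F) (x : A) (N : ℕ) : A :=
  ∑ k ∈ Finset.range N, (qfact q k)⁻¹ • x ^ k


section helpers
variable {F : Type*} [Field F] {A : Type*} [Ring A] [Algebra F A]

lemma qint_mul_aux (q : F) (hq0 : q ≠ 0) (k : ℕ) :
    qint q k * (q - q⁻¹) = q ^ k - q⁻¹ ^ k := by
  unfold qint
  have h := (Commute.all q⁻¹ q).geom_sum₂_mul k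
  have h2 : ∑ i ∈ Finset.range k, q ^ (k - 1 - i) * q⁻¹ ^ i
      = ∑ i ∈ Finset.range k, q⁻¹ ^ i * q ^ (k - 1 - i) :=
    Finset.sum_congr rfl fun i _ => mul_comm _ _
  rw [h2]
  linear_combination -h

lemma q_sub_ne (q : F) (hq0 : q ≠ 0) (hq : ∀ k : ℕ, k ≠ 0 → q ^ k ≠ 1) : q - q⁻¹ ≠ 0 := by
  intro h
  apply hq 2 two_ne_zero
  field_simp at h
  linear_combination h

lemma qint_ne (q : F) (hq0 : q ≠ 0) (hq : ∀ k : ℕ, k ≠ 0 → q ^ k ≠ 1) (k : ℕ) (hk : k ≠ 0) :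
    qint q k ≠ 0 := by
  intro h
  have h1 := qint_mul_aux q hq0 k
  rw [h, zero_mul, inv_pow] at h1
  apply hq (2 * k) (by omega)
  have : q ^ k ≠ 0 := pow_ne_zero _ hq0
  field_simp at h1
  rw [mul_comm, pow_mul]
  linear_combination -h1

lemma qint_add (q : F) (hq0 : q ≠ 0) (hq : ∀ k : ℕ, k ≠ 0 → q ^ k ≠ 1) (k l : ℕ) :
    q⁻¹ ^ l * qint q k + q ^ k * qint q l = qint q (k + l) := by
  apply mul_right_cancel₀ (q_sub_ne q hq0 hq)
  have h1 := qint_mul_aux q hq0 k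
  have h2 := qint_mul_aux q hq0 l
  have h3 := qint_mul_aux q hq0 (k + l)
  rw [pow_add, pow_add] at h3
  linear_combination q⁻¹ ^ l * h1 + q ^ k * h2 - h3

lemma qfact_ne (q : F) (hq0 : q ≠ 0) (hq : ∀ k : ℕ, k ≠ 0 → q ^ k ≠ 1) (k : ℕ) :
    qfact q k ≠ 0 := by
  induction k with
  | zero => simp [qfact]
  | succ k ih => exact mul_ne_zero ih (qint_ne q hq0 hq _ (by omega))

/-- divided power -/
def qdp (q : F) (x : A) (k : ℕ) : A := (qfact q k)⁻¹ • x ^ k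

lemma mul_qdp (q : F) (hq0 : q ≠ 0) (hq : ∀ k : ℕ, k ≠ 0 → q ^ k ≠ 1) (x : A) (k : ℕ) :
    x * qdp q x k = qint q (k + 1) • qdp q x (k + 1) := by
  have h1 := qfact_ne q hq0 hq k
  have h2 := qint_ne q hq0 hq (k + 1) (by omega)
  unfold qdp
  rw [smul_smul, mul_smul_comm, ← pow_succ']
  congr 1
  simp only [qfact]
  field_simp

lemma mul_pow_q (c : F) (x y : A) (h : y * x = c • (x * y)) (k : ℕ) :
    y * x ^ k = c ^ k • (x ^ k * y) := by
  induction k with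
  | zero => simp
  | succ k ih =>
    rw [pow_succ, ← mul_assoc, ih, smul_mul_assoc, mul_assoc, h, mul_smul_comm, smul_smul,
      ← pow_succ, mul_assoc]

lemma mul_qdp_q (q c : F) (x y : A) (h : y * x = c • (x * y)) (k : ℕ) :
    y * qdp q x k = c ^ k • (qdp q x k * y) := by
  unfold qdp
  rw [mul_smul_comm, mul_pow_q c x y h, smul_mul_assoc, smul_comm]

lemma qdp_add (q : F) (hq0 : q ≠ 0) (hq : ∀ k : ℕ, k ≠ 0 → q ^ k ≠ 1) (x y K : A)
    (hyx : y * x = q • (x * y)) (hK : K * x = x * K) (hKy : K * y = q⁻¹ • (y * K)) (n : ℕ) :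
    qdp q (x * K + y) n
      = ∑ p ∈ Finset.HasAntidiagonal.antidiagonal n, qdp q x p.1 * qdp q y p.2 * K ^ p.1 := by
  induction n with
  | zero => simp [qdp, qfact]
  | succ n ih =>
    have h2 := qint_ne q hq0 hq (n + 1) (by omega)
    have e := mul_qdp q hq0 hq (x * K + y) n
    apply smul_right_injective A h2
    simp only
    rw [← e, ih, Finset.mul_sum, Finset.smul_sum]
    have t1 : ∀ p : ℕ × ℕ, (x * K + y) * (qdp q x p.1 * qdp q y p.2 * K ^ p.1)
        = (q⁻¹ ^ p.2 * qint q (p.1 + 1)) • (qdp q x (p.1 + 1) * qdp q y p.2 * K ^ (p.1 + 1))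
        + (q ^ p.1 * qint q (p.2 + 1)) • (qdp q x p.1 * qdp q y (p.2 + 1) * K ^ p.1) := by
      rintro ⟨k, l⟩
      simp only
      have hKx : K * qdp q x k = qdp q x k * K := by
        have := mul_qdp_q q (1 : F) x K (by rw [one_smul, hK]) k
        simpa using this
      have hKy' := mul_qdp_q q q⁻¹ y K hKy l
      have hyx' := mul_qdp_q q q x y hyx k
      have a1 := mul_qdp q hq0 hq x k
      have a2 := mul_qdp q hq0 hq y l
      rw [add_mul]
      congr 1
      · calc x * K * (qdp q x k * qdp q y l * K ^ k)
            = x * (K * qdp q x k) * qdp q y l * K ^ k := by simp only [mul_assoc]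
          _ = (x * qdp q x k) * (K * qdp q y l) * K ^ k := by rw [hKx]; simp only [mul_assoc]
          _ = _ := by
            rw [a1, hKy', pow_succ']
            simp only [mul_assoc, smul_mul_assoc, mul_smul_comm, smul_smul]
      · calc y * (qdp q x k * qdp q y l * K ^ k)
            = (y * qdp q x k) * qdp q y l * K ^ k := by simp only [mul_assoc]
          _ = q ^ k • (qdp q x k * (y * qdp q y l) * K ^ k) := by
            rw [hyx']; simp only [mul_assoc, smul_mul_assoc]
          _ = _ := by
            rw [a2]
            simp only [mul_assoc, smul_mul_assoc, mul_smul_comm, smul_smul]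
    rw [Finset.sum_congr rfl fun p _ => t1 p, Finset.sum_add_distrib]
    have t2 : ∀ p ∈ Finset.HasAntidiagonal.antidiagonal (n + 1),
        qint q (n + 1) • (qdp q x p.1 * qdp q y p.2 * K ^ p.1)
        = (q⁻¹ ^ p.2 * qint q p.1) • (qdp q x p.1 * qdp q y p.2 * K ^ p.1)
        + (q ^ p.1 * qint q p.2) • (qdp q x p.1 * qdp q y p.2 * K ^ p.1) := by
      intro p hp
      rw [← add_smul, qint_add q hq0 hq, Finset.HasAntidiagonal.mem_antidiagonal.1 hp]
    rw [Finset.sum_congr rfl t2, Finset.sum_add_distrib]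
    congr 1
    · rw [Finset.Nat.sum_antidiagonal_succ]
      simp [qint]
    · rw [Finset.Nat.sum_antidiagonal_succ']
      simp [qint]

lemma qdp_zero_of_le (q : F) (x : A) (N k : ℕ) (h : x ^ N = 0) (hk : N ≤ k) : qdp q x k = 0 := by
  rw [qdp, pow_eq_zero_of_le hk h, smul_zero]

lemma expqTrunc_eq (q : F) (x : A) (N N' : ℕ) (h : x ^ N = 0) (hk : N ≤ N') :
    expqTrunc q x N = ∑ k ∈ Finset.range N', qdp q x k := by
  unfold expqTrunc
  apply Finset.sum_subset (Finset.range_mono hk)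
  intro k _ hk
  exact qdp_zero_of_le q x N k h (by simpa using hk)

lemma qadd_nil (q : F) (hq0 : q ≠ 0) (hq : ∀ k : ℕ, k ≠ 0 → q ^ k ≠ 1) (x y K : A)
    (hyx : y * x = q • (x * y)) (hK : K * x = x * K) (hKy : K * y = q⁻¹ • (y * K))
    (hx : IsNilpotent x) (hy : IsNilpotent y) : IsNilpotent (x * K + y) := by
  obtain ⟨a, ha⟩ := hx
  obtain ⟨b, hb⟩ := hy
  refine ⟨a + b, ?_⟩
  have h := qdp_add q hq0 hq x y K hyx hK hKy (a + b)
  rw [Finset.sum_eq_zero] at h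
  · rw [qdp] at h
    exact (smul_eq_zero.1 h).resolve_left (inv_ne_zero (qfact_ne q hq0 hq _))
  · intro p hp
    have := Finset.HasAntidiagonal.mem_antidiagonal.1 hp
    rcases le_or_gt a p.1 with h1 | h1
    · rw [qdp_zero_of_le q x a _ ha h1]; simp
    · rw [qdp_zero_of_le q y b _ hb (by omega)]; simp

lemma expq_two (q : F) (hq0 : q ≠ 0) (hq : ∀ k : ℕ, k ≠ 0 → q ^ k ≠ 1) (x y K : A)
    (hyx : y * x = q • (x * y)) (hK : K * x = x * K) (hKy : K * y = q⁻¹ • (y * K))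
    (M : Type*) [AddCommGroup M] [Module A M] (v : M) (hv : K • v = v)
    (a b c : ℕ) (ha : x ^ a = 0) (hb : y ^ b = 0) (hc : (x * K + y) ^ c = 0) :
    expqTrunc q (x * K + y) c • v = expqTrunc q x a • expqTrunc q y b • v := by
  have hKv : ∀ k : ℕ, K ^ k • v = v := by
    intro k
    induction k with
    | zero => simp
    | succ k ih => rw [pow_succ, mul_smul, hv, ih]
  rw [expqTrunc_eq q _ c (a + b + c) hc (by omega), expqTrunc_eq q x a a ha le_rfl,
    expqTrunc_eq q y b b hb le_rfl, ← mul_smul, Finset.sum_mul_sum, ← Finset.sum_product',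
    Finset.sum_smul, Finset.sum_smul]
  rw [← Finset.sum_fiberwise_of_maps_to (s := Finset.range a ×ˢ Finset.range b)
    (t := Finset.range (a + b + c)) (g := fun p => p.1 + p.2)]
  · apply Finset.sum_congr rfl
    intro n _
    rw [qdp_add q hq0 hq x y K hyx hK hKy n, Finset.sum_smul]
    symm
    rw [Finset.sum_congr rfl (g := fun p : ℕ × ℕ => (qdp q x p.1 * qdp q y p.2 * K ^ p.1) • v)]
    · apply Finset.sum_subset
      · intro p hp
        simp only [Finset.mem_filter] at hp
        simpa using hp.2
      · intro p hp hp'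
        have hp := Finset.HasAntidiagonal.mem_antidiagonal.1 hp
        simp only [Finset.mem_filter, Finset.mem_product, Finset.mem_range, hp, and_true] at hp'
        rcases le_or_gt a p.1 with h1 | h1
        · rw [qdp_zero_of_le q x a _ ha h1]; simp
        · rw [qdp_zero_of_le q y b _ hb (by omega)]; simp
    · intro p _
      rw [mul_smul _ (K ^ p.1), hKv]
  · intro p hp
    simp only [Finset.mem_product, Finset.mem_range] at hp ⊢
    omega

lemma expq_O_succ (r : ℕ) (B K : Fin (r + 1) → A) :
    (∑ a, B a * (List.ofFn fun b : Fin (r + 1) => if a < b then K b else 1).prod)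
    = (∑ a : Fin r, B a.castSucc *
        (List.ofFn fun b : Fin r => if a < b then K b.castSucc else 1).prod) * K (Fin.last r)
      + B (Fin.last r) := by
  rw [Fin.sum_univ_castSucc, Finset.sum_mul]
  congr 1
  · apply Finset.sum_congr rfl
    intro a _
    rw [List.ofFn_succ', List.concat_eq_append, List.prod_append]
    simp [Fin.castSucc_lt_last, mul_assoc]
  · have : (fun b : Fin (r + 1) => if Fin.last r < b then K b else 1) = fun _ => 1 := by
      funext b
      rw [if_neg (not_lt.2 (Fin.le_last b))]
    rw [this]
    simp

lemma expq_core (q : F) (hq0 : q ≠ 0) (hq : ∀ k : ℕ, k ≠ 0 → q ^ k ≠ 1)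
    (r : ℕ) (B K : Fin r → A)
    (hBnil : ∀ i, IsNilpotent (B i))
    (hKcomm : ∀ i j, K i * K j = K j * K i)
    (hKB : ∀ i j, i ≠ j → K i * B j = B j * K i)
    (hKBq : ∀ i, K i * B i = q⁻¹ • (B i * K i))
    (hBB : ∀ i j, i < j → B j * B i = q • (B i * B j)) :
    IsNilpotent (∑ a, B a * (List.ofFn fun b : Fin r => if a < b then K b else 1).prod) ∧
      ∀ (M : Type*) [AddCommGroup M] [Module A M]
        (v : M), (∀ i, K i • v = v) →
        ∀ NO : ℕ,
          (∑ a, B a * (List.ofFn fun b : Fin r => if a < b then K b else 1).prod) ^ NO = 0 →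
        ∀ NB : Fin r → ℕ, (∀ i, B i ^ NB i = 0) →
          expqTrunc q (∑ a, B a * (List.ofFn fun b : Fin r => if a < b then K b else 1).prod) NO
              • v
            = (List.ofFn fun i : Fin r => expqTrunc q (B i) (NB i)).prod • v := by
  induction r with
  | zero =>
    refine ⟨by simp, ?_⟩
    intro M _ _ v _ NO hNO NB _
    simp only [Finset.univ_eq_empty, Finset.sum_empty, List.ofFn_zero, List.prod_nil] at hNO ⊢
    rcases Nat.eq_zero_or_pos NO with h | h
    · subst h
      have h1 : (1 : A) = 0 := by simpa using hNO
      rw [h1, zero_smul, expqTrunc]; simp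
    · have e : expqTrunc q (0 : A) NO = expqTrunc q (0 : A) 1 := by
        rw [expqTrunc_eq q (0 : A) 1 NO (by simp) h, expqTrunc_eq q (0 : A) NO NO hNO le_rfl]
      rw [e, expqTrunc]
      simp [qfact]
  | succ r ih =>
    obtain ⟨ih1, ih2⟩ := ih (fun i => B i.castSucc) (fun i => K i.castSucc)
      (fun i => hBnil _) (fun i j => hKcomm _ _)
      (fun i j h => hKB _ _ (by simpa using h)) (fun i => hKBq _)
      (fun i j h => hBB _ _ (by simpa using h))
    rw [expq_O_succ]
    set X := ∑ a : Fin r, B a.castSucc *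
        (List.ofFn fun b : Fin r => if a < b then K b.castSucc else 1).prod with hX
    have hprod : ∀ (z : A) (a : Fin r), (∀ b : Fin r, z * K b.castSucc = K b.castSucc * z) →
        Commute z (List.ofFn fun b : Fin r => if a < b then K b.castSucc else 1).prod := by
      intro z a hz
      apply Commute.list_prod_right
      intro u hu
      rw [List.mem_ofFn] at hu
      obtain ⟨b, rfl⟩ := hu
      split_ifs
      · exact hz b
      · exact Commute.one_right z
    have hyx : B (Fin.last r) * X = q • (X * B (Fin.last r)) := by
      rw [hX, Finset.mul_sum, Finset.sum_mul, Finset.smul_sum]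
      apply Finset.sum_congr rfl
      intro a _
      have h := hprod (B (Fin.last r)) a
        (fun b => (hKB _ _ (Fin.castSucc_lt_last b).ne).symm)
      rw [← mul_assoc, hBB _ _ (Fin.castSucc_lt_last a), smul_mul_assoc, mul_assoc, h.eq,
        mul_assoc]
    have hKX : K (Fin.last r) * X = X * K (Fin.last r) := by
      rw [hX, Finset.mul_sum, Finset.sum_mul]
      apply Finset.sum_congr rfl
      intro a _
      have h := hprod (K (Fin.last r)) a (fun b => hKcomm _ _)
      rw [← mul_assoc, hKB _ _ (Fin.castSucc_lt_last a).ne', mul_assoc, h.eq, mul_assoc]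
    have hKy := hKBq (Fin.last r)
    refine ⟨qadd_nil q hq0 hq _ _ _ hyx hKX hKy ih1 (hBnil _), ?_⟩
    intro M _ _ v hv NO hNO NB hNB
    obtain ⟨a, ha⟩ := ih1
    rw [expq_two q hq0 hq _ _ _ hyx hKX hKy M v (hv _) a _ NO ha (hNB _) hNO]
    rw [ih2 M _ ?_ a ha (fun i => NB i.castSucc) (fun i => hNB _)]
    · rw [List.ofFn_succ', List.concat_eq_append, List.prod_append, mul_smul]
      simp
    · intro i
      have hc : Commute (K i.castSucc) (expqTrunc q (B (Fin.last r)) (NB (Fin.last r))) := by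
        unfold expqTrunc
        apply Commute.sum_right
        intro k _
        apply Commute.smul_right
        apply Commute.pow_right
        exact hKB _ _ (Fin.castSucc_lt_last i).ne
      rw [← mul_smul, hc.eq, mul_smul, hv]

end helpers

/-- Multi-factor q-exponential factorization: with nilpotent `B_1, …, B_r`, invertible pairwise
commuting `K_1, …, K_r`, `K_i B_j = B_j K_i (i ≠ j)`, `K_i B_i = q⁻¹ B_i K_i`,
`B_j B_i = q B_i B_j (i < j)`, the element `𝒪 = ∑_a B_a K_{a+1} ⋯ K_r` is nilpotent, and on a
vector `v` with `K_i v = v` one has `exp_q(𝒪) v = exp_q(B_1) ⋯ exp_q(B_r) v`. -/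
theorem expq_factorization_multi {F : Type*} [Field F] {A : Type*} [Ring A] [Algebra F A]
    (q : F) (hq0 : q ≠ 0) (hq : ∀ k : ℕ, k ≠ 0 → q ^ k ≠ 1)
    (r : ℕ) (hr : 1 ≤ r) (B K : Fin r → A)
    (hBnil : ∀ i, IsNilpotent (B i))
    (hKunit : ∀ i, IsUnit (K i))
    (hKcomm : ∀ i j, K i * K j = K j * K i)
    (hKB : ∀ i j, i ≠ j → K i * B j = B j * K i)
    (hKBq : ∀ i, K i * B i = q⁻¹ • (B i * K i))
    (hBB : ∀ i j, i < j → B j * B i = q • (B i * B j)) :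
    IsNilpotent (∑ a, B a * (List.ofFn fun b : Fin r => if a < b then K b else 1).prod) ∧
      ∀ (M : Type*) [AddCommGroup M] [Module A M] [Module F M] [IsScalarTower F A M]
        (v : M), (∀ i, K i • v = v) →
        ∀ NO : ℕ,
          (∑ a, B a * (List.ofFn fun b : Fin r => if a < b then K b else 1).prod) ^ NO = 0 →
        ∀ NB : Fin r → ℕ, (∀ i, B i ^ NB i = 0) →
          expqTrunc q (∑ a, B a * (List.ofFn fun b : Fin r => if a < b then K b else 1).prod) NO
              • v
            = (List.ofFn fun i : Fin r => expqTrunc q (B i) (NB i)).prod • v := by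
  have h := expq_core q hq0 hq r B K hBnil hKcomm hKB hKBq hBB
  exact ⟨h.1, fun M _ _ _ _ v hv NO hNO NB hNB => h.2 M v hv NO hNO NB hNB⟩
end

section
/- In $U_q(gl(m|n))$, let $a < b$ and $c \in \mathbf{I}'$. (i) If $a \notin \{c, c+1\}$ and $b \notin \{c, c+1\}$, then $[E_{a\,b}, E_{c\,c+1}\} = 0$ and $[E_{b\,a}, E_{c+1\,c}\} = 0$. (ii) If $a \notin \{c, c+1\}$ or $b \notin \{c, c+1\}$, then $[E_{a\,b}, E_{c+1\,c}\} = \delta_{b,c+1}\, E_{a\,c}\, K_c K_{c+1}^{-1}\, q_c^{-1} - \delta_{a,c}\, (-1)^{\delta_{cm}}\, E_{c+1\,b}\, K_c^{-1} K_{c+1}$ and $[E_{b\,a}, E_{c\,c+1}\} = \delta_{a,c}\, E_{b\,c+1}\, K_c K_{c+1}^{-1}\, q_{c+1} - \delta_{b,c+1}\, (-1)^{\delta_{cm}}\, E_{c\,a}\, K_c^{-1} K_{c+1}$. (Here the graded brackets are taken with respect to the assigned parities: $p(E_{a\,b}) = p(E_{b\,a}) = [a]+[b]$, $p(E_{c\,c+1})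 = p(E_{c+1\,c}) = [c]+[c+1] = \delta_{cm}$, all mod 2.) -/
open scoped BigOperators

/-- Parity `[a]` of the (1-based) index `a`: `0` for `a ≤ m`, `1` for `a > m`. -/
def par (m a : ℕ) : ℕ := if a ≤ m then 0 else 1

/-- `q_a = q^{(-1)^{[a]}}`: equals `q` for `a ≤ m` and `q⁻¹` for `a > m`. -/
def qpar {F : Type*} [Field F] (q : F) (m a : ℕ) : F := if a ≤ m then q else q⁻¹

/-- `Eup q m e a k = E_{a, a+k+1}`, built recursively from the simple raising generators
`e b = E_{b, b+1}` via `E_{a b} = E_{a c} E_{c b} - q_c⁻¹ E_{c b} E_{a c}` with `c = b - 1`. -/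
def Eup {F : Type*} [Field F] {A : Type*} [Ring A] [Algebra F A]
    (q : F) (m : ℕ) (e : ℕ → A) (a : ℕ) : ℕ → A
  | 0 => e a
  | k + 1 =>
      Eup q m e a k * e (a + k + 1) - (qpar q m (a + k + 1))⁻¹ • (e (a + k + 1) * Eup q m e a k)

/-- `Edown q m f a k = E_{a+k+1, a}`, built recursively from the simple lowering generators
`f b = E_{b+1, b}` via `E_{b a} = E_{b c} E_{c a} - q_c E_{c a} E_{b c}` with `c = b - 1`. -/
def Edown {F : Type*} [Field F] {A : Type*} [Ring A] [Algebra F A]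
    (q : F) (m : ℕ) (f : ℕ → A) (a : ℕ) : ℕ → A
  | 0 => f a
  | k + 1 =>
      f (a + k + 1) * Edown q m f a k - qpar q m (a + k + 1) • (Edown q m f a k * f (a + k + 1))

/-- The root vectors `E_{a b}` of `U_q(gl(m|n))` (and `0` for `a = b`, a value never used). -/
def EE {F : Type*} [Field F] {A : Type*} [Ring A] [Algebra F A]
    (q : F) (m : ℕ) (e f : ℕ → A) (a b : ℕ) : A :=
  if a < b then Eup q m e a (b - a - 1) else if b < a then Edown q m f b (a - b - 1) else 0

/-- A realization of the defining presentation of the quantum supergroup `U_q(gl(m|n))` in a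
unital associative `F`-algebra `A`: elements `K a`, `Kinv a` (`a ∈ I = {1,…,m+n}`) and
`e b = E_{b,b+1}`, `f b = E_{b+1,b}` (`b ∈ I' = {1,…,m+n-1}`) subject to the defining
relations of `U_q(gl(m|n))`. -/
structure UqGl (F : Type*) [Field F] (A : Type*) [Ring A] [Algebra F A]
    (m n : ℕ) (q : F) where
  K : ℕ → A
  Kinv : ℕ → A
  e : ℕ → A
  f : ℕ → A
  K_Kinv : ∀ a, 1 ≤ a → a ≤ m + n → K a * Kinv a = 1
  Kinv_K : ∀ a, 1 ≤ a → a ≤ m + n → Kinv a * K a = 1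
  K_comm : ∀ a b, 1 ≤ a → a ≤ m + n → 1 ≤ b → b ≤ m + n → K a * K b = K b * K a
  K_e : ∀ a b, 1 ≤ a → a ≤ m + n → 1 ≤ b → b + 1 ≤ m + n →
    K a * e b * Kinv a
      = (if a = b then qpar q m a else if a = b + 1 then (qpar q m a)⁻¹ else 1) • e b
  K_f : ∀ a b, 1 ≤ a → a ≤ m + n → 1 ≤ b → b + 1 ≤ m + n →
    K a * f b * Kinv a
      = (if a = b + 1 then qpar q m a else if a = b then (qpar q m a)⁻¹ else 1) • f b
  e_f : ∀ a b, 1 ≤ a → a + 1 ≤ m + n → 1 ≤ b → b + 1 ≤ m + n →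
    e a * f b - (if a = m ∧ b = m then (-1 : F) else 1) • (f b * e a)
      = if a = b
          then (qpar q m a - (qpar q m a)⁻¹)⁻¹ • (K a * Kinv (a + 1) - Kinv a * K (a + 1))
          else 0
  e_m_sq : e m ^ 2 = 0
  f_m_sq : f m ^ 2 = 0
  e_e : ∀ a b, 1 ≤ a → a + 1 ≤ m + n → 1 ≤ b → b + 1 ≤ m + n →
    (a + 2 ≤ b ∨ b + 2 ≤ a) → e a * e b = e b * e a
  f_f : ∀ a b, 1 ≤ a → a + 1 ≤ m + n → 1 ≤ b → b + 1 ≤ m + n →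
    (a + 2 ≤ b ∨ b + 2 ≤ a) → f a * f b = f b * f a
  serre_e : ∀ a b, 1 ≤ a → a + 1 ≤ m + n → 1 ≤ b → b + 1 ≤ m + n → a ≠ m →
    (b = a + 1 ∨ a = b + 1) →
    e a ^ 2 * e b - (q + q⁻¹) • (e a * e b * e a) + e b * e a ^ 2 = 0
  serre_f : ∀ a b, 1 ≤ a → a + 1 ≤ m + n → 1 ≤ b → b + 1 ≤ m + n → a ≠ m →
    (b = a + 1 ∨ a = b + 1) →
    f a ^ 2 * f b - (q + q⁻¹) • (f a * f b * f a) + f b * f a ^ 2 = 0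
  serre_extra_e : 2 ≤ m → 2 ≤ n →
    EE q m e f (m - 1) (m + 2) * e m + e m * EE q m e f (m - 1) (m + 2) = 0
  serre_extra_f : 2 ≤ m → 2 ≤ n →
    EE q m e f (m + 2) (m - 1) * f m + f m * EE q m e f (m + 2) (m - 1) = 0

section Abs
variable {F : Type*} [Field F] {A : Type*} [Ring A] [Algebra F A]

theorem abs_pos_form (x y : A) (s : F) (hs : s * s = 1) (z : A) (h : x - s • y = z) :
    y - s • x = - (s • z) := by
  subst h
  rw [smul_sub, smul_smul, hs]; module

theorem abs_scomm (X Y t : A) (r s u : F) (hX : X * t = s • (t * X)) (hY : Y * t = u • (t * Y)) :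
    (X * Y - r • (Y * X)) * t = (s * u) • (t * (X * Y - r • (Y * X))) := by
  have hX' : ∀ w, X * (t * w) = s • (t * (X * w)) := fun w => by
    rw [← mul_assoc, hX, smul_mul_assoc, mul_assoc]
  have hY' : ∀ w, Y * (t * w) = u • (t * (Y * w)) := fun w => by
    rw [← mul_assoc, hY, smul_mul_assoc, mul_assoc]
  simp only [mul_sub, sub_mul, smul_mul_assoc, mul_smul_comm, mul_assoc, hX, hY, hX', hY']
  module

theorem abs_scommL (X Y t : A) (r s u : F) (hX : t * X = s • (X * t)) (hY : t * Y = u • (Y * t)) :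
    t * (X * Y - r • (Y * X)) = (s * u) • ((X * Y - r • (Y * X)) * t) := by
  have hX' : ∀ w, t * (X * w) = s • (X * (t * w)) := fun w => by
    rw [← mul_assoc, hX, smul_mul_assoc, mul_assoc]
  have hY' : ∀ w, t * (Y * w) = u • (Y * (t * w)) := fun w => by
    rw [← mul_assoc, hY, smul_mul_assoc, mul_assoc]
  simp only [mul_sub, sub_mul, smul_mul_assoc, mul_smul_comm, mul_assoc, hX, hY, hX', hY']
  module

theorem abs_serre (x y z : A) (p : F) (hp : p ≠ 0) (hs : p + p⁻¹ ≠ 0) (hxz : x * z = z * x)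
    (h1 : y ^ 2 * x - (p + p⁻¹) • (y * x * y) + x * y ^ 2 = 0)
    (h2 : y ^ 2 * z - (p + p⁻¹) • (y * z * y) + z * y ^ 2 = 0) :
    ((x * y - p⁻¹ • (y * x)) * z - p⁻¹ • (z * (x * y - p⁻¹ • (y * x)))) * y =
    y * ((x * y - p⁻¹ • (y * x)) * z - p⁻¹ • (z * (x * y - p⁻¹ • (y * x)))) := by
  have e1 : y * (x * y) = (p + p⁻¹)⁻¹ • (y * (y * x) + x * (y * y)) := by
    rw [eq_inv_smul_iff₀ hs]
    simp only [pow_two, mul_assoc] at h1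
    linear_combination (norm := module) (-1:F) • h1
  have e2 : y * (z * y) = (p + p⁻¹)⁻¹ • (y * (y * z) + z * (y * y)) := by
    rw [eq_inv_smul_iff₀ hs]
    simp only [pow_two, mul_assoc] at h2
    linear_combination (norm := module) (-1:F) • h2
  have e1' : ∀ w, y * (x * (y * w)) = (p + p⁻¹)⁻¹ • (y * (y * (x * w)) + x * (y * (y * w))) :=
    fun w => by
      have := congrArg (· * w) e1
      simpa only [smul_mul_assoc, add_mul, mul_assoc] using this
  have e2' : ∀ w, y * (z * (y * w)) = (p + p⁻¹)⁻¹ • (y * (y * (z * w)) + z * (y * (y * w))) :=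
    fun w => by
      have := congrArg (· * w) e2
      simpa only [smul_mul_assoc, add_mul, mul_assoc] using this
  have hxz' : ∀ w, x * (z * w) = z * (x * w) := fun w => by
    rw [← mul_assoc, hxz, mul_assoc]
  have hs' : p ^ 2 + 1 ≠ 0 := by
    intro h; apply hs; field_simp; simpa using h
  simp only [mul_sub, sub_mul, mul_add, add_mul, smul_mul_assoc, mul_smul_comm, mul_assoc, hxz,
    hxz', e1, e2, e1', e2']
  match_scalars <;> field_simp <;> ring

theorem abs_end (G Y f T T' : A) (p s : F) (hp : p ≠ 0) (hp1 : p - p⁻¹ ≠ 0)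
    (hG : G * f = f * G) (hY : Y * f = s • (f * Y) + (p - p⁻¹)⁻¹ • (T - T'))
    (hT : T * G = p⁻¹ • (G * T)) (hT' : T' * G = p • (G * T')) :
    (G * Y - p⁻¹ • (Y * G)) * f = s • (f * (G * Y - p⁻¹ • (Y * G))) + p⁻¹ • (G * T) := by
  have hG' : ∀ w, G * (f * w) = f * (G * w) := fun w => by
    rw [← mul_assoc, hG, mul_assoc]
  have hY' : ∀ w, Y * (f * w) = s • (f * (Y * w)) + (p - p⁻¹)⁻¹ • (T * w - T' * w) := fun w => by
    rw [← mul_assoc, hY]; simp only [add_mul, sub_mul, smul_mul_assoc, mul_assoc]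
  have hs' : p ^ 2 - 1 ≠ 0 := by
    intro h; apply hp1; field_simp; simpa using h
  simp only [mul_sub, sub_mul, mul_add, add_mul, smul_mul_assoc, mul_smul_comm, mul_assoc, hG,
    hG', hY, hY', hT, hT']
  match_scalars <;> field_simp <;> ring

theorem abs_start (G Y f T T' : A) (p h s : F) (hp : p ≠ 0) (hs : h * (p - p⁻¹) = s)
    (hG : G * f = f * G) (hY : Y * f = s • (f * Y) + h • (T - T'))
    (hT : T * G = p⁻¹ • (G * T)) (hT' : T' * G = p • (G * T')) :
    (Y * G - p⁻¹ • (G * Y)) * f = s • (f * (Y * G - p⁻¹ • (G * Y))) - s • (G * T') := by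
  have hG' : ∀ w, G * (f * w) = f * (G * w) := fun w => by
    rw [← mul_assoc, hG, mul_assoc]
  have hY' : ∀ w, Y * (f * w) = s • (f * (Y * w)) + h • (T * w - T' * w) := fun w => by
    rw [← mul_assoc, hY]; simp only [add_mul, sub_mul, smul_mul_assoc, mul_assoc]
  subst hs
  simp only [mul_sub, sub_mul, mul_add, add_mul, smul_mul_assoc, mul_smul_comm, mul_assoc, hG,
    hG', hY, hY', hT, hT']
  match_scalars <;> field_simp <;> ring

theorem abs_mid (X Y f G T : A) (r s p : F)
    (hX : X * f = s • (f * X) + r • (G * T)) (hY : Y * f = f * Y) (hG : G * Y = Y * G)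
    (hT : T * Y = p • (Y * T)) :
    (X * Y - p • (Y * X)) * f = s • (f * (X * Y - p • (Y * X))) := by
  have hX' : ∀ w, X * (f * w) = s • (f * (X * w)) + r • (G * (T * w)) := fun w => by
    rw [← mul_assoc, hX]; simp only [add_mul, sub_mul, smul_mul_assoc, mul_assoc]
  have hY' : ∀ w, Y * (f * w) = f * (Y * w) := fun w => by
    rw [← mul_assoc, hY, mul_assoc]
  have hG' : ∀ w, G * (Y * w) = Y * (G * w) := fun w => by
    rw [← mul_assoc, hG, mul_assoc]
  simp only [mul_sub, sub_mul, mul_add, add_mul, smul_mul_assoc, mul_smul_comm, mul_assoc, hG,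
    hG', hY, hY', hX, hX', hT]
  module

theorem abs_left (X Y Z : A) (r r' : F) (h : X * Z = Z * X) :
    (X * Y - r • (Y * X)) * Z - r' • (Z * (X * Y - r • (Y * X))) =
    X * (Y * Z - r' • (Z * Y)) - r • ((Y * Z - r' • (Z * Y)) * X) := by
  have h' : ∀ w, X * (Z * w) = Z * (X * w) := fun w => by
    rw [← mul_assoc, h, mul_assoc]
  simp only [mul_sub, sub_mul, smul_mul_assoc, mul_smul_comm, mul_assoc, h, h']
  module

end Abs

section Up
variable {F : Type*} [Field F] {A : Type*} [Ring A] [Algebra F A] {m n : ℕ} {q : F}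

theorem qpar_ne (hq0 : q ≠ 0) (c : ℕ) : qpar q m c ≠ 0 := by
  unfold qpar; split_ifs <;> simp [hq0]

theorem qpar_sub_ne (hq0 : q ≠ 0) (hq : ∀ k : ℕ, k ≠ 0 → q ^ k ≠ 1) (c : ℕ) :
    qpar q m c - (qpar q m c)⁻¹ ≠ 0 := by
  have h2 := hq 2 (by norm_num)
  have : q - q⁻¹ ≠ 0 := by
    intro h; field_simp at h; apply h2; linear_combination h
  unfold qpar; split_ifs
  · exact this
  · rw [inv_inv]; intro h; apply this; linear_combination -h

theorem qpar_add_inv (c : ℕ) : qpar q m c + (qpar q m c)⁻¹ = q + q⁻¹ := by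
  unfold qpar; split_ifs
  · rfl
  · rw [inv_inv, add_comm]

theorem q_add_ne (hq0 : q ≠ 0) (hq : ∀ k : ℕ, k ≠ 0 → q ^ k ≠ 1) : q + q⁻¹ ≠ 0 := by
  have h4 := hq 4 (by norm_num)
  intro h; field_simp at h; apply h4; linear_combination (q^2-1) * h

theorem qpar_succ (c : ℕ) (h : c ≠ m) : qpar q m (c + 1) = qpar q m c := by
  unfold qpar
  by_cases h1 : c ≤ m
  · rw [if_pos h1, if_pos (by omega)]
  · rw [if_neg h1, if_neg (by omega)]

theorem qpar_m : qpar q m (m + 1) = (qpar q m m)⁻¹ := by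
  unfold qpar; simp

theorem qpar_inv (c : ℕ) : qpar q⁻¹ m c = (qpar q m c)⁻¹ := by
  unfold qpar; split_ifs <;> simp

theorem Eup_comm (e : ℕ → A) (t : A) (a k : ℕ)
    (h : ∀ j, a ≤ j → j ≤ a + k → e j * t = t * e j) :
    Eup q m e a k * t = t * Eup q m e a k := by
  induction k with
  | zero => exact h a le_rfl le_rfl
  | succ k ih =>
    have := abs_scomm (Eup q m e a k) (e (a+k+1)) t (qpar q m (a + k + 1))⁻¹ (1:F) 1
      (by rw [one_smul]; exact ih fun j h1 h2 => h j h1 (by omega))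
      (by rw [one_smul]; exact h _ (by omega) (by omega))
    simpa [Eup] using this

theorem Eup_first (e : ℕ → A) (t : A) (a k : ℕ) (w : F)
    (ha : t * e a = w • (e a * t))
    (h : ∀ j, a < j → j ≤ a + k → t * e j = e j * t) :
    t * Eup q m e a k = w • (Eup q m e a k * t) := by
  induction k with
  | zero => exact ha
  | succ k ih =>
    have := abs_scommL (Eup q m e a k) (e (a+k+1)) t (qpar q m (a + k + 1))⁻¹ w 1
      (ih fun j h1 h2 => h j h1 (by omega))
      (by rw [one_smul]; exact h _ (by omega) (by omega))
    simpa [Eup] using this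

theorem Eup_last (e : ℕ → A) (t : A) (a k : ℕ) (w : F)
    (ha : t * e (a + k) = w • (e (a + k) * t))
    (h : ∀ j, a ≤ j → j < a + k → t * e j = e j * t) :
    t * Eup q m e a k = w • (Eup q m e a k * t) := by
  cases k with
  | zero => exact ha
  | succ k =>
    have := abs_scommL (Eup q m e a k) (e (a+k+1)) t (qpar q m (a + k + 1))⁻¹ 1 w
      (by rw [one_smul]; exact (Eup_comm e t a k fun j h1 h2 => (h j h1 (by omega)).symm).symm)
      ha
    simpa [Eup] using this

variable (U : UqGl F A m n q)
include U

theorem Eup_left (a k : ℕ) (ha : 1 ≤ a) (hk : a + k + 2 ≤ m + n) :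
    Eup q m U.e a (k + 1) = U.e a * Eup q m U.e (a + 1) k
      - (qpar q m (a + 1))⁻¹ • (Eup q m U.e (a + 1) k * U.e a) := by
  induction k with
  | zero => rfl
  | succ k ih =>
    have e1 : a + 1 + k + 1 = a + (k + 1) + 1 := by omega
    rw [Eup, ih (by omega), Eup.eq_2 q m U.e (a + 1) k, e1]
    exact abs_left _ _ _ _ _ (U.e_e _ _ (by omega) (by omega) (by omega) (by omega) (by omega))

theorem Ke (hq0 : q ≠ 0) (a b : ℕ) (h1 : 1 ≤ a) (h2 : a ≤ m + n) (h3 : 1 ≤ b)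
    (h4 : b + 1 ≤ m + n) :
    U.K a * U.e b
      = (if a = b then qpar q m a else if a = b + 1 then (qpar q m a)⁻¹ else 1) • (U.e b * U.K a) := by
  have h := congrArg (· * U.K a) (U.K_e a b h1 h2 h3 h4)
  simpa only [mul_assoc, U.Kinv_K a h1 h2, mul_one, smul_mul_assoc] using h

theorem Kinve (hq0 : q ≠ 0) (a b : ℕ) (h1 : 1 ≤ a) (h2 : a ≤ m + n) (h3 : 1 ≤ b)
    (h4 : b + 1 ≤ m + n) :
    U.Kinv a * U.e b
      = (if a = b then (qpar q m a)⁻¹ else if a = b + 1 then qpar q m a else 1) • (U.e b * U.Kinv a) := by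
  have h := congrArg (U.Kinv a * ·) (U.K_e a b h1 h2 h3 h4)
  simp only [← mul_assoc, U.Kinv_K a h1 h2, one_mul, mul_smul_comm] at h
  rw [h, smul_smul]
  have := qpar_ne (m := m) hq0 a
  split_ifs <;> simp [this]

theorem Kc (a b : ℕ) (h1 : 1 ≤ a) (h2 : a ≤ m + n) (h3 : 1 ≤ b) (h4 : b ≤ m + n) :
    U.K a * U.Kinv b = U.Kinv b * U.K a := by
  have h := congrArg (fun x => U.Kinv b * x * U.Kinv b) (U.K_comm a b h1 h2 h3 h4)
  simp only [mul_assoc, U.K_Kinv b h3 h4, mul_one] at h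
  simp only [← mul_assoc, U.Kinv_K b h3 h4, one_mul] at h
  exact h.symm

theorem Kic (a b : ℕ) (h1 : 1 ≤ a) (h2 : a ≤ m + n) (h3 : 1 ≤ b) (h4 : b ≤ m + n) :
    U.Kinv a * U.Kinv b = U.Kinv b * U.Kinv a := by
  have h := congrArg (fun x => U.Kinv a * x * U.Kinv a) (Kc U a b h1 h2 h3 h4)
  simp only [mul_assoc, U.K_Kinv a h1 h2, mul_one] at h
  simp only [← mul_assoc, U.Kinv_K a h1 h2, one_mul] at h
  exact h.symm

theorem Te_gen (T S x : A) (u v : F) (hT : T * x = u • (x * T)) (hS : S * x = v • (x * S)) :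
    (T * S) * x = (u * v) • (x * (T * S)) := by
  rw [mul_assoc, hS, mul_smul_comm, ← mul_assoc, hT, smul_mul_assoc, smul_smul, mul_assoc, mul_comm]

/-- `T = K_c K_{c+1}⁻¹`. -/
theorem Te (hq0 : q ≠ 0) (c b : ℕ) (h1 : 1 ≤ c) (h2 : c + 1 ≤ m + n) (h3 : 1 ≤ b)
    (h4 : b + 1 ≤ m + n) (hbc : b ≠ c) :
    (U.K c * U.Kinv (c + 1)) * U.e b = (if b + 1 = c then (qpar q m c)⁻¹ else
      if b = c + 1 then (qpar q m (c + 1))⁻¹ else 1) • (U.e b * (U.K c * U.Kinv (c + 1))) := by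
  rw [Te_gen U _ _ _ _ _ (Ke U hq0 c b h1 (by omega) h3 h4)
    (Kinve U hq0 (c+1) b (by omega) h2 h3 h4)]
  congr 1
  split_ifs <;> first | omega | simp

theorem Te' (hq0 : q ≠ 0) (c b : ℕ) (h1 : 1 ≤ c) (h2 : c + 1 ≤ m + n) (h3 : 1 ≤ b)
    (h4 : b + 1 ≤ m + n) (hbc : b ≠ c) :
    (U.Kinv c * U.K (c + 1)) * U.e b = (if b + 1 = c then (qpar q m c) else
      if b = c + 1 then (qpar q m (c + 1)) else 1) • (U.e b * (U.Kinv c * U.K (c + 1))) := by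
  rw [Te_gen U _ _ _ _ _ (Kinve U hq0 c b h1 (by omega) h3 h4)
    (Ke U hq0 (c+1) b (by omega) h2 h3 h4)]
  congr 1
  split_ifs <;> first | omega | simp

theorem ef_ne (a b : ℕ) (h1 : 1 ≤ a) (h2 : a + 1 ≤ m + n) (h3 : 1 ≤ b) (h4 : b + 1 ≤ m + n)
    (h : a ≠ b) : U.e a * U.f b = U.f b * U.e a := by
  have := U.e_f a b h1 h2 h3 h4
  rw [if_neg h, if_neg (by omega), one_smul] at this
  exact sub_eq_zero.1 this

theorem ef_eq (c : ℕ) (h1 : 1 ≤ c) (h2 : c + 1 ≤ m + n) :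
    U.e c * U.f c = (if c = m then (-1 : F) else 1) • (U.f c * U.e c) +
      (qpar q m c - (qpar q m c)⁻¹)⁻¹ • (U.K c * U.Kinv (c + 1) - U.Kinv c * U.K (c + 1)) := by
  have := U.e_f c c h1 h2 h1 h2
  rw [if_pos rfl] at this
  simp only [and_self] at this
  rw [← this]; module

theorem up_end (hq0 : q ≠ 0) (hq : ∀ k : ℕ, k ≠ 0 → q ^ k ≠ 1) (a d : ℕ) (ha : 1 ≤ a)
    (hd : a + d + 2 ≤ m + n) :
    Eup q m U.e a (d + 1) * U.f (a + d + 1) =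
      (if a + d + 1 = m then (-1 : F) else 1) • (U.f (a + d + 1) * Eup q m U.e a (d + 1)) +
      (qpar q m (a + d + 1))⁻¹ •
        (Eup q m U.e a d * (U.K (a + d + 1) * U.Kinv (a + d + 1 + 1))) := by
  rw [Eup]
  refine abs_end _ _ _ _ _ _ _ (qpar_ne hq0 _) (qpar_sub_ne hq0 hq _) ?_
    (ef_eq U _ (by omega) (by omega)) ?_ ?_
  · exact Eup_comm _ _ _ _ fun j h1 h2 =>
      ef_ne U _ _ (by omega) (by omega) (by omega) (by omega) (by omega)
  · refine Eup_last _ _ _ _ _ ?_ fun j h1 h2 => ?_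
    · rw [Te U hq0 _ _ (by omega) (by omega) (by omega) (by omega) (by omega), if_pos rfl]
    · rw [Te U hq0 _ _ (by omega) (by omega) (by omega) (by omega) (by omega), if_neg (by omega),
        if_neg (by omega), one_smul]
  · refine Eup_last _ _ _ _ _ ?_ fun j h1 h2 => ?_
    · rw [Te' U hq0 _ _ (by omega) (by omega) (by omega) (by omega) (by omega), if_pos rfl]
    · rw [Te' U hq0 _ _ (by omega) (by omega) (by omega) (by omega) (by omega), if_neg (by omega),
        if_neg (by omega), one_smul]

theorem up_start (hq0 : q ≠ 0) (hq : ∀ k : ℕ, k ≠ 0 → q ^ k ≠ 1) (c d : ℕ) (ha : 1 ≤ c)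
    (hd : c + d + 2 ≤ m + n) :
    Eup q m U.e c (d + 1) * U.f c =
      (if c = m then (-1 : F) else 1) • (U.f c * Eup q m U.e c (d + 1)) -
      (if c = m then (-1 : F) else 1) •
        (Eup q m U.e (c + 1) d * (U.Kinv c * U.K (c + 1))) := by
  rw [Eup_left U c d ha hd]
  refine abs_start _ _ _ _ _ _ _ _ (qpar_ne hq0 _) ?_ ?_
    (ef_eq U _ (by omega) (by omega)) ?_ ?_
  · have h := qpar_sub_ne (m := m) hq0 hq c
    split_ifs with hc
    · subst hc
      rw [qpar_m, inv_inv]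
      rw [inv_mul_eq_iff_eq_mul₀ h]; ring
    · rw [qpar_succ _ hc, inv_mul_cancel₀ h]
  · exact Eup_comm _ _ _ _ fun j h1 h2 =>
      ef_ne U _ _ (by omega) (by omega) (by omega) (by omega) (by omega)
  · refine Eup_first _ _ _ _ _ ?_ fun j h1 h2 => ?_
    · rw [Te U hq0 _ _ (by omega) (by omega) (by omega) (by omega) (by omega), if_neg (by omega),
        if_pos rfl]
    · rw [Te U hq0 _ _ (by omega) (by omega) (by omega) (by omega) (by omega), if_neg (by omega),
        if_neg (by omega), one_smul]
  · refine Eup_first _ _ _ _ _ ?_ fun j h1 h2 => ?_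
    · rw [Te' U hq0 _ _ (by omega) (by omega) (by omega) (by omega) (by omega), if_neg (by omega),
        if_pos rfl]
    · rw [Te' U hq0 _ _ (by omega) (by omega) (by omega) (by omega) (by omega), if_neg (by omega),
        if_neg (by omega), one_smul]

theorem up_mid_f (hq0 : q ≠ 0) (hq : ∀ k : ℕ, k ≠ 0 → q ^ k ≠ 1) (a d l : ℕ) (ha : 1 ≤ a)
    (hd : a + d + l + 3 ≤ m + n) :
    Eup q m U.e a (d + l + 2) * U.f (a + d + 1) =
      (if a + d + 1 = m then (-1 : F) else 1) •
        (U.f (a + d + 1) * Eup q m U.e a (d + l + 2)) := by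
  induction l with
  | zero =>
    rw [show d + 0 + 2 = (d + 1) + 1 from rfl, Eup]
    refine abs_mid _ _ _ _ _ _ _ _ (up_end U hq0 hq a d ha (by omega)) ?_ ?_ ?_
    · exact ef_ne U _ _ (by omega) (by omega) (by omega) (by omega) (by omega)
    · exact Eup_comm _ _ _ _ fun j h1 h2 =>
        U.e_e _ _ (by omega) (by omega) (by omega) (by omega) (by omega)
    · rw [Te U hq0 _ _ (by omega) (by omega) (by omega) (by omega) (by omega), if_neg (by omega),
        if_pos (by omega)]
      rfl
  | succ l ih =>
    rw [show d + (l + 1) + 2 = (d + l + 2) + 1 by omega, Eup]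
    have := abs_scomm _ (U.e (a + (d + l + 2) + 1)) _ (qpar q m (a + (d + l + 2) + 1))⁻¹ _ 1
      (ih (by omega))
      (by rw [one_smul]; exact ef_ne U _ _ (by omega) (by omega) (by omega) (by omega) (by omega))
    rwa [mul_one] at this

theorem up_mid_e0 (hq0 : q ≠ 0) (hq : ∀ k : ℕ, k ≠ 0 → q ^ k ≠ 1) (a : ℕ) (ha : 1 ≤ a)
    (hd : a + 3 ≤ m + n) :
    Eup q m U.e a 2 * U.e (a + 1) =
      (if a + 1 = m then (-1 : F) else 1) • (U.e (a + 1) * Eup q m U.e a 2) := by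
  split_ifs with h
  · have := U.serre_extra_e (by omega) (by omega)
    rw [EE, if_pos (by omega), show m + 2 - (m - 1) - 1 = 2 by omega, show m - 1 = a by omega] at this
    rw [show U.e (a + 1) = U.e m by rw [h]]
    linear_combination (norm := module) (1:F) • this
  · rw [one_smul]
    have hp := qpar_add_inv (q := q) (m := m) (a + 1)
    have e1 := U.serre_e (a+1) a (by omega) (by omega) (by omega) (by omega) h (by omega)
    have e2 := U.serre_e (a+1) (a+1+1) (by omega) (by omega) (by omega) (by omega) h (by omega)
    rw [← hp] at e1 e2
    have := abs_serre _ _ _ _ (qpar_ne hq0 _) (by rw [hp]; exact q_add_ne hq0 hq)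
      (U.e_e a (a+1+1) (by omega) (by omega) (by omega) (by omega) (by omega)) e1 e2
    simp only [Eup]
    rw [show a + 0 + 1 = a + 1 from rfl, qpar_succ _ h]
    exact this

theorem up_mid_e (hq0 : q ≠ 0) (hq : ∀ k : ℕ, k ≠ 0 → q ^ k ≠ 1) (a d l : ℕ) (ha : 1 ≤ a)
    (hd : a + d + l + 3 ≤ m + n) :
    Eup q m U.e a (d + l + 2) * U.e (a + d + 1) =
      (if a + d + 1 = m then (-1 : F) else 1) •
        (U.e (a + d + 1) * Eup q m U.e a (d + l + 2)) := by
  induction d generalizing a with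
  | zero =>
    induction l with
    | zero => exact up_mid_e0 U hq0 hq a ha hd
    | succ l ih =>
      rw [show 0 + (l + 1) + 2 = (0 + l + 2) + 1 by omega, Eup]
      have := abs_scomm _ (U.e (a + (0 + l + 2) + 1)) _ (qpar q m (a + (0 + l + 2) + 1))⁻¹ _ 1
        (ih (by omega))
        (by rw [one_smul]; exact U.e_e _ _ (by omega) (by omega) (by omega) (by omega) (by omega))
      rwa [mul_one] at this
  | succ d ih =>
    rw [show d + 1 + l + 2 = (d + l + 2) + 1 by omega, Eup_left U _ _ ha (by omega)]
    have h := ih (a + 1) (by omega) (by omega)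
    rw [show a + 1 + d + 1 = a + (d + 1) + 1 by omega] at h
    have := abs_scomm (U.e a) _ _ (qpar q m (a + 1))⁻¹ 1 _
      (by rw [one_smul]; exact U.e_e _ _ (by omega) (by omega) (by omega) (by omega) (by omega)) h
    rwa [one_mul] at this

end Up

theorem sign_triv {F : Type*} [Field F] (m a b c : ℕ) (h : c ≠ m ∨ b ≤ m ∨ m < a) (hab : a < b) :
    ((-1 : F) ^ ((par m a + par m b) * (par m c + par m (c + 1)))) = 1 := by
  unfold par
  split_ifs <;> first | omega | norm_num

theorem sign_c {F : Type*} [Field F] (m a b c : ℕ) (h : a ≤ c) (hb : c + 1 ≤ b) :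
    ((-1 : F) ^ ((par m a + par m b) * (par m c + par m (c + 1)))) =
      if c = m then (-1 : F) else 1 := by
  unfold par
  split_ifs <;> first | omega | norm_num

section Main
variable {F : Type*} [Field F] {A : Type*} [Ring A] [Algebra F A] {m n : ℕ} {q : F}
  (U : UqGl F A m n q)
include U

theorem main_up_e (hq0 : q ≠ 0)
    (hq : ∀ k : ℕ, k ≠ 0 → q ^ k ≠ 1)
    (a b c : ℕ) (ha : 1 ≤ a) (hab : a < b) (hb : b ≤ m + n)
    (hc1 : 1 ≤ c) (hc2 : c + 1 ≤ m + n) (h1 : a ≠ c ∧ a ≠ c + 1) (h2 : b ≠ c ∧ b ≠ c + 1) :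
      EE q m U.e U.f a b * U.e c
          - ((-1 : F) ^ ((par m a + par m b) * (par m c + par m (c + 1)))) •
              (U.e c * EE q m U.e U.f a b) = 0 := by
  rw [sub_eq_zero, EE, if_pos hab]
  by_cases h : a < c ∧ c + 1 < b
  · rw [sign_c _ _ _ _ (by omega) (by omega)]
    obtain ⟨d, rfl⟩ : ∃ d, c = a + d + 1 := ⟨c - a - 1, by omega⟩
    obtain ⟨l, rfl⟩ : ∃ l, b = a + d + l + 3 := ⟨b - (a + d + 3), by omega⟩
    rw [show a + d + l + 3 - a - 1 = d + l + 2 by omega]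
    exact up_mid_e U hq0 hq a d l ha hb
  · rw [sign_triv _ _ _ _ (by omega) hab, one_smul]
    exact Eup_comm _ _ _ _ fun j h1 h2 =>
      U.e_e _ _ (by omega) (by omega) (by omega) (by omega) (by omega)

theorem main_up_f (hq0 : q ≠ 0)
    (hq : ∀ k : ℕ, k ≠ 0 → q ^ k ≠ 1)
    (a b c : ℕ) (ha : 1 ≤ a) (hab : a < b) (hb : b ≤ m + n)
    (hc1 : 1 ≤ c) (hc2 : c + 1 ≤ m + n)
    (h : (a ≠ c ∧ a ≠ c + 1) ∨ (b ≠ c ∧ b ≠ c + 1)) :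
      EE q m U.e U.f a b * U.f c
          - ((-1 : F) ^ ((par m a + par m b) * (par m c + par m (c + 1)))) •
              (U.f c * EE q m U.e U.f a b)
        = (if b = c + 1 then (qpar q m c)⁻¹ else 0) •
              (EE q m U.e U.f a c * (U.K c * U.Kinv (c + 1)))
          - (if a = c then (if c = m then (-1 : F) else 1) else 0) •
              (EE q m U.e U.f (c + 1) b * (U.Kinv c * U.K (c + 1))) := by
  rw [EE, if_pos hab]
  by_cases h3 : c < a ∨ b ≤ c
  · rw [sign_triv _ _ _ _ (by omega) hab, one_smul, if_neg (by omega), if_neg (by omega),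
      zero_smul, zero_smul, sub_zero, sub_eq_zero]
    exact Eup_comm _ _ _ _ fun j h1 h2 =>
      ef_ne U _ _ (by omega) (by omega) (by omega) (by omega) (by omega)
  rw [sign_c _ _ _ _ (by omega) (by omega)]
  by_cases h4 : b = c + 1
  · subst h4
    obtain ⟨d, rfl⟩ : ∃ d, c = a + d + 1 := ⟨c - a - 1, by omega⟩
    have := up_end U hq0 hq a d ha (by omega)
    rw [if_pos rfl, if_neg (by omega : ¬ a = a + d + 1), zero_smul, EE, if_pos (by omega : a < a + d + 1),
      show a + d + 1 - a - 1 = d by omega, show a + d + 1 + 1 - a - 1 = d + 1 by omega, this]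
    module
  rw [if_neg h4]
  by_cases h5 : a = c
  · subst h5
    obtain ⟨d, rfl⟩ : ∃ d, b = a + d + 2 := ⟨b - a - 2, by omega⟩
    have := up_start U hq0 hq a d ha (by omega)
    rw [if_pos rfl, zero_smul, EE.eq_1 q m U.e U.f (a+1), if_pos (by omega : a + 1 < a + d + 2),
      show a + d + 2 - a - 1 = d + 1 by omega, show a + d + 2 - (a + 1) - 1 = d by omega, this]
    module
  · rw [if_neg h5, zero_smul, zero_smul, sub_zero, sub_eq_zero]
    obtain ⟨d, rfl⟩ : ∃ d, c = a + d + 1 := ⟨c - a - 1, by omega⟩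
    obtain ⟨l, rfl⟩ : ∃ l, b = a + d + l + 3 := ⟨b - (a + d + 3), by omega⟩
    rw [show a + d + l + 3 - a - 1 = d + l + 2 by omega]
    exact up_mid_f U hq0 hq a d l ha hb

end Main

section Op
open MulOpposite
variable {F : Type*} [Field F] {A : Type*} [Ring A] [Algebra F A] {m n : ℕ} {q : F}

theorem Eup_op (f : ℕ → A) (a k : ℕ) :
    Eup q⁻¹ m (fun i => op (f i)) a k = op (Edown q m f a k) := by
  induction k with
  | zero => rfl
  | succ k ih => rw [Eup, ih, Edown, qpar_inv, inv_inv]; rfl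

theorem Edown_op (e : ℕ → A) (a k : ℕ) :
    Edown q⁻¹ m (fun i => op (e i)) a k = op (Eup q m e a k) := by
  induction k with
  | zero => rfl
  | succ k ih => rw [Edown, ih, Eup, qpar_inv]; rfl

theorem EE_op (e f : ℕ → A) (a b : ℕ) :
    EE q⁻¹ m (fun i => op (f i)) (fun i => op (e i)) a b = op (EE q m e f b a) := by
  unfold EE
  by_cases h : a < b
  · rw [if_pos h, if_neg (by omega), if_pos h, Eup_op]
  · by_cases h' : b < a
    · rw [if_neg h, if_pos h', if_pos h', Edown_op]
    · rw [if_neg h, if_neg h', if_neg h', if_neg h]; rfl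

/-- The anti-automorphism `e ↔ f`, `K ↔ K⁻¹`, `q ↔ q⁻¹`. -/
def UqGl.opp (U : UqGl F A m n q) : UqGl F Aᵐᵒᵖ m n q⁻¹ where
  K i := op (U.Kinv i)
  Kinv i := op (U.K i)
  e i := op (U.f i)
  f i := op (U.e i)
  K_Kinv a h1 h2 := by rw [← op_mul, U.K_Kinv a h1 h2]; rfl
  Kinv_K a h1 h2 := by rw [← op_mul, U.Kinv_K a h1 h2]; rfl
  K_comm a b h1 h2 h3 h4 := by rw [← op_mul, ← op_mul, Kic U a b h1 h2 h3 h4]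
  K_e a b h1 h2 h3 h4 := by
    rw [← op_mul, ← op_mul, ← mul_assoc, U.K_f a b h1 h2 h3 h4, op_smul, qpar_inv]
    congr 1
    split_ifs <;> first | omega | simp
  K_f a b h1 h2 h3 h4 := by
    rw [← op_mul, ← op_mul, ← mul_assoc, U.K_e a b h1 h2 h3 h4, op_smul, qpar_inv]
    congr 1
    split_ifs <;> first | omega | simp
  e_f a b h1 h2 h3 h4 := by
    have h := congrArg op (U.e_f b a h3 h4 h1 h2)
    have hab : (b = m ∧ a = m) ↔ (a = m ∧ b = m) := and_comm
    simp only [hab] at h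
    rw [op_sub, op_smul, op_mul, op_mul] at h
    rw [h]
    by_cases hh : a = b
    · subst hh
      rw [if_pos rfl, if_pos rfl, qpar_inv, inv_inv, ← op_mul, ← op_mul, ← op_sub, ← op_smul,
        Kc U (a+1) a (by omega) h2 (by omega) (by omega), ← Kc U a (a+1) (by omega) (by omega) (by omega) h2,
        ← neg_sub (qpar q m a), inv_neg, neg_smul, ← smul_neg, neg_sub]
    · rw [if_neg hh, if_neg (Ne.symm hh)]; rfl
  e_m_sq := by rw [← op_pow, U.f_m_sq]; rfl
  f_m_sq := by rw [← op_pow, U.e_m_sq]; rfl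
  e_e a b h1 h2 h3 h4 h := by rw [← op_mul, ← op_mul, U.f_f a b h1 h2 h3 h4 h]
  f_f a b h1 h2 h3 h4 h := by rw [← op_mul, ← op_mul, U.e_e a b h1 h2 h3 h4 h]
  serre_e a b h1 h2 h3 h4 h5 h6 := by
    have h := congrArg op (U.serre_f a b h1 h2 h3 h4 h5 h6)
    simp only [op_add, op_sub, op_smul, op_mul, op_pow, op_zero, ← mul_assoc] at h
    rw [inv_inv, add_comm q⁻¹, ← h]; abel
  serre_f a b h1 h2 h3 h4 h5 h6 := by
    have h := congrArg op (U.serre_e a b h1 h2 h3 h4 h5 h6)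
    simp only [op_add, op_sub, op_smul, op_mul, op_pow, op_zero, ← mul_assoc] at h
    rw [inv_inv, add_comm q⁻¹, ← h]; abel
  serre_extra_e h1 h2 := by
    rw [EE_op, ← op_mul, ← op_mul, ← op_add, add_comm, U.serre_extra_f h1 h2]; rfl
  serre_extra_f h1 h2 := by
    rw [EE_op, ← op_mul, ← op_mul, ← op_add, add_comm, U.serre_extra_e h1 h2]; rfl

end Op

theorem sign_sq {F : Type*} [Field F] (k : ℕ) : ((-1 : F) ^ k) * (-1) ^ k = 1 := by
  rw [← mul_pow]; simp

section Main2
open MulOpposite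
variable {F : Type*} [Field F] {A : Type*} [Ring A] [Algebra F A] {m n : ℕ} {q : F}
  (U : UqGl F A m n q)
include U

theorem main_down_f (hq0 : q ≠ 0)
    (hq : ∀ k : ℕ, k ≠ 0 → q ^ k ≠ 1)
    (a b c : ℕ) (ha : 1 ≤ a) (hab : a < b) (hb : b ≤ m + n)
    (hc1 : 1 ≤ c) (hc2 : c + 1 ≤ m + n) (h1 : a ≠ c ∧ a ≠ c + 1) (h2 : b ≠ c ∧ b ≠ c + 1) :
      EE q m U.e U.f b a * U.f c
          - ((-1 : F) ^ ((par m a + par m b) * (par m c + par m (c + 1)))) •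
              (U.f c * EE q m U.e U.f b a) = 0 := by
  have h := main_up_e U.opp (inv_ne_zero hq0)
    (fun k hk h => hq k hk (by rwa [inv_pow, inv_eq_one] at h)) a b c ha hab hb hc1 hc2 h1 h2
  have h := congrArg unop h
  simp only [UqGl.opp, EE_op, unop_sub, unop_smul, unop_mul, unop_op, unop_zero] at h
  rw [abs_pos_form _ _ _ (sign_sq _) _ h]; simp

theorem main_down_e (hq0 : q ≠ 0)
    (hq : ∀ k : ℕ, k ≠ 0 → q ^ k ≠ 1)
    (a b c : ℕ) (ha : 1 ≤ a) (hab : a < b) (hb : b ≤ m + n)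
    (hc1 : 1 ≤ c) (hc2 : c + 1 ≤ m + n)
    (h : (a ≠ c ∧ a ≠ c + 1) ∨ (b ≠ c ∧ b ≠ c + 1)) :
        EE q m U.e U.f b a * U.e c
          - ((-1 : F) ^ ((par m a + par m b) * (par m c + par m (c + 1)))) •
              (U.e c * EE q m U.e U.f b a)
        = (if a = c then qpar q m (c + 1) else 0) •
              (EE q m U.e U.f b (c + 1) * (U.K c * U.Kinv (c + 1)))
          - (if b = c + 1 then (if c = m then (-1 : F) else 1) else 0) •
              (EE q m U.e U.f c a * (U.Kinv c * U.K (c + 1))) := by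
  have hq0' := inv_ne_zero hq0
  have h0 := main_up_f U.opp hq0'
    (fun k hk h => hq k hk (by rwa [inv_pow, inv_eq_one] at h)) a b c ha hab hb hc1 hc2 h
  have h1 := congrArg unop h0
  simp only [UqGl.opp, EE_op, unop_sub, unop_smul, unop_mul, unop_op] at h1
  rw [abs_pos_form _ _ _ (sign_sq _) _ h1]
  have hp := qpar_ne (m := m) hq0
  by_cases h4 : b = c + 1
  · subst h4
    rw [if_pos rfl, if_pos rfl, if_neg (by omega), if_neg (by omega), sign_c _ _ _ _ (by omega) le_rfl]
    have hT : (op (U.Kinv c) * op (U.K (c + 1))) * EE q⁻¹ m U.opp.e U.opp.f a c = qpar q m c •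
        (EE q⁻¹ m U.opp.e U.opp.f a c * (op (U.Kinv c) * op (U.K (c + 1)))) := by
      rw [EE, if_pos (by omega)]
      refine Eup_last _ _ _ _ _ ?_ fun j h1 h2 => ?_
      · refine (Te U.opp hq0' _ _ (by omega) (by omega) (by omega) (by omega) (by omega)).trans ?_
        rw [if_pos (by omega), qpar_inv, inv_inv]; rfl
      · refine (Te U.opp hq0' _ _ (by omega) (by omega) (by omega) (by omega) (by omega)).trans ?_
        rw [if_neg (by omega), if_neg (by omega), one_smul]; rfl
    have hT := congrArg unop hT
    simp only [UqGl.opp, EE_op, unop_smul, unop_mul, unop_op] at hT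
    rw [← Kc U (c+1) c (by omega) (by omega) (by omega) (by omega), hT, qpar_inv, inv_inv]
    simp
  rw [if_neg h4, if_neg h4]
  by_cases h5 : a = c
  · subst h5
    rw [if_pos rfl, if_pos rfl, sign_c _ _ _ _ (by omega) (by omega)]
    have hT : (op (U.K a) * op (U.Kinv (a + 1))) * EE q⁻¹ m U.opp.e U.opp.f (a+1) b =
        (qpar q m (a+1))⁻¹ •
        (EE q⁻¹ m U.opp.e U.opp.f (a+1) b * (op (U.K a) * op (U.Kinv (a + 1)))) := by
      rw [EE, if_pos (by omega)]
      refine Eup_first _ _ _ _ _ ?_ fun j h1 h2 => ?_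
      · refine (Te' U.opp hq0' _ _ (by omega) (by omega) (by omega) (by omega) (by omega)).trans ?_
        rw [if_neg (by omega), if_pos (by omega), qpar_inv]; rfl
      · refine (Te' U.opp hq0' _ _ (by omega) (by omega) (by omega) (by omega) (by omega)).trans ?_
        rw [if_neg (by omega), if_neg (by omega), one_smul]; rfl
    have hT := congrArg unop hT
    simp only [UqGl.opp, EE_op, unop_smul, unop_mul, unop_op] at hT
    rw [Kc U a (a+1) (by omega) (by omega) (by omega) (by omega), hT, smul_smul,
      mul_inv_cancel₀ (hp _)]
    split_ifs <;> simp
  · rw [if_neg h5, if_neg h5]; simp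

end Main2

/-- Graded brackets of the root vectors `E_{ab}` (`a < b`) with the simple generators
`e c = E_{c c+1}`, `f c = E_{c+1 c}` of `U_q(gl(m|n))`:
(i) if `a, b ∉ {c, c+1}` then `[E_{ab}, E_{c c+1}} = 0` and `[E_{ba}, E_{c+1 c}} = 0`;
(ii) if `a ∉ {c, c+1}` or `b ∉ {c, c+1}` then
`[E_{ab}, E_{c+1 c}} = δ_{b,c+1} E_{ac} K_c K_{c+1}⁻¹ q_c⁻¹ - δ_{ac} (-1)^{δ_{cm}} E_{c+1 b} K_c⁻¹ K_{c+1}`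
and
`[E_{ba}, E_{c c+1}} = δ_{ac} E_{b c+1} K_c K_{c+1}⁻¹ q_{c+1} - δ_{b,c+1} (-1)^{δ_{cm}} E_{ca} K_c⁻¹ K_{c+1}`. -/
theorem EE_bracket_simple {F : Type*} [Field F] {A : Type*} [Ring A] [Algebra F A]
    (m n : ℕ) (hm : 1 ≤ m) (hn : 1 ≤ n) (q : F) (hq0 : q ≠ 0)
    (hq : ∀ k : ℕ, k ≠ 0 → q ^ k ≠ 1) (U : UqGl F A m n q)
    (a b c : ℕ) (ha : 1 ≤ a) (hab : a < b) (hb : b ≤ m + n)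
    (hc1 : 1 ≤ c) (hc2 : c + 1 ≤ m + n) :
    ((a ≠ c ∧ a ≠ c + 1) → (b ≠ c ∧ b ≠ c + 1) →
      EE q m U.e U.f a b * U.e c
          - ((-1 : F) ^ ((par m a + par m b) * (par m c + par m (c + 1)))) •
              (U.e c * EE q m U.e U.f a b) = 0 ∧
        EE q m U.e U.f b a * U.f c
          - ((-1 : F) ^ ((par m a + par m b) * (par m c + par m (c + 1)))) •
              (U.f c * EE q m U.e U.f b a) = 0) ∧
    (((a ≠ c ∧ a ≠ c + 1) ∨ (b ≠ c ∧ b ≠ c + 1)) →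
      EE q m U.e U.f a b * U.f c
          - ((-1 : F) ^ ((par m a + par m b) * (par m c + par m (c + 1)))) •
              (U.f c * EE q m U.e U.f a b)
        = (if b = c + 1 then (qpar q m c)⁻¹ else 0) •
              (EE q m U.e U.f a c * (U.K c * U.Kinv (c + 1)))
          - (if a = c then (if c = m then (-1 : F) else 1) else 0) •
              (EE q m U.e U.f (c + 1) b * (U.Kinv c * U.K (c + 1))) ∧
        EE q m U.e U.f b a * U.e c
          - ((-1 : F) ^ ((par m a + par m b) * (par m c + par m (c + 1)))) •
              (U.e c * EE q m U.e U.f b a)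
        = (if a = c then qpar q m (c + 1) else 0) •
              (EE q m U.e U.f b (c + 1) * (U.K c * U.Kinv (c + 1)))
          - (if b = c + 1 then (if c = m then (-1 : F) else 1) else 0) •
              (EE q m U.e U.f c a * (U.Kinv c * U.K (c + 1)))) := by
  exact ⟨fun h1 h2 => ⟨main_up_e U hq0 hq a b c ha hab hb hc1 hc2 h1 h2,
      main_down_f U hq0 hq a b c ha hab hb hc1 hc2 h1 h2⟩,
    fun h => ⟨main_up_f U hq0 hq a b c ha hab hb hc1 hc2 h,
      main_down_e U hq0 hq a b c ha hab hb hc1 hc2 h⟩⟩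
end
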